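/- Let (V,b) ≈ (V',b') be nonsingular finite-dimensional metric spaces over F, and let 𝒱 = {V_i}_{i=0,…,k} and 𝒱' = {V_i'}_{i=0,…,k'} be self-dual flags of V and V' respectively. Then 𝒱 ≈ 𝒱' if and only if k = k' and dim V_i = dim V_i' for i = 1,…,⌊k/2⌋. -/

import Mathlib

open Module

namespace Witt

variable {F V V' : Type*} [Field F] [AddCommGroup V] [Module F V]
  [AddCommGroup V'] [Module F V']

/-- A linear equivalence `φ : E ≃ E'` between subspaces is an isometry if it
preserves the ambient bilinear forms. -/
def IsIsometryOn (B : LinearMap.BilinForm F V) (B' : LinearMap.BilinForm F V')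
    (E : Submodule F V) (E' : Submodule F V') (φ : E ≃ₗ[F] E') : Prop :=
  ∀ u v : E, B' (φ u : V') (φ v : V') = B (u : V) (v : V)

/-- A linear equivalence of the whole spaces which preserves the forms. -/
def IsIsometry (B : LinearMap.BilinForm F V) (B' : LinearMap.BilinForm F V')
    (ψ : V ≃ₗ[F] V') : Prop :=
  ∀ u v : V, B' (ψ u) (ψ v) = B u v

/-- The two metric spaces `(V,B)` and `(V',B')` are isometric. -/
def AreIsometric (B : LinearMap.BilinForm F V) (B' : LinearMap.BilinForm F V') : Prop :=
  ∃ ψ : V ≃ₗ[F] V', IsIsometry B B' ψ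

/-- The subspaces `N ⊆ V` and `N' ⊆ V'` are isometric with respect to the
restrictions of the ambient forms. -/
def SubIsometric (B : LinearMap.BilinForm F V) (B' : LinearMap.BilinForm F V')
    (N : Submodule F V) (N' : Submodule F V') : Prop :=
  ∃ ψ : N ≃ₗ[F] N', IsIsometryOn B B' N N' ψ

/-- A subspace is totally isotropic. -/
def TotIsotropic (B : LinearMap.BilinForm F V) (N : Submodule F V) : Prop :=
  ∀ u ∈ N, ∀ v ∈ N, B u v = 0

end Witt

open Module Witt

namespace Witt

variable {F V V' : Type*} [Field F] [AddCommGroup V] [Module F V]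
  [AddCommGroup V'] [Module F V']

theorem IsIsometry.trans {V'' : Type*} [AddCommGroup V''] [Module F V'']
    {B : LinearMap.BilinForm F V} {B' : LinearMap.BilinForm F V'}
    {B'' : LinearMap.BilinForm F V''} {φ : V ≃ₗ[F] V'} {ψ : V' ≃ₗ[F] V''}
    (hφ : IsIsometry B B' φ) (hψ : IsIsometry B' B'' ψ) :
    IsIsometry B B'' (φ.trans ψ) := fun u v => by
  simp only [LinearEquiv.trans_apply, hψ _ _, hφ _ _]

/-- The reflection along an anisotropic vector is an isometry. -/
theorem exists_reflection {B : LinearMap.BilinForm F V} (hB : ∀ u v, B u v = B v u)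
    {a : V} (ha : B a a ≠ 0) :
    ∃ g : V ≃ₗ[F] V, IsIsometry B B g ∧ ∀ v, g v = v - (2 * B a v / B a a) • a := by
  have h2 : ((2 / B a a) • B a) a = 2 := by
    simp [ha]
  have hg : ∀ v, Module.reflection h2 v = v - (2 * B a v / B a a) • a := fun v => by
    rw [Module.reflection_apply, LinearMap.smul_apply, smul_eq_mul, div_mul_eq_mul_div]
  refine ⟨Module.reflection h2, fun u v => ?_, hg⟩
  rw [hg, hg]
  simp only [map_sub, map_smul, LinearMap.sub_apply, LinearMap.smul_apply, smul_eq_mul]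
  rw [hB u a]
  field_simp
  ring

/-- Two isotropic vectors which are not orthogonal to each other are swapped by a reflection,
which fixes every vector orthogonal to both. -/
theorem exists_isometry_of_apply_ne_zero (hchar : (2 : F) ≠ 0)
    {B : LinearMap.BilinForm F V} (hB : ∀ u v, B u v = B v u)
    {x y : V} (hx : B x x = 0) (hy : B y y = 0) (hxy : B x y ≠ 0) :
    ∃ g : V ≃ₗ[F] V, IsIsometry B B g ∧ g x = y ∧
      ∀ h, B h x = 0 → B h y = 0 → g h = h := by
  have haa : B (x - y) (x - y) = -(2 * B x y) := by
    simp only [map_sub, LinearMap.sub_apply, hx, hy, hB y x]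
    ring
  have ha : B (x - y) (x - y) ≠ 0 := by
    rw [haa]
    exact neg_ne_zero.mpr (mul_ne_zero hchar hxy)
  obtain ⟨g, hg, hgv⟩ := exists_reflection hB ha
  refine ⟨g, hg, ?_, fun h h1 h2 => ?_⟩
  · have hax : 2 * B (x - y) x / B (x - y) (x - y) = 1 := by
      rw [div_eq_one_iff_eq ha, haa, map_sub, LinearMap.sub_apply, hx, hB y x]
      ring
    rw [hgv, hax, one_smul, sub_sub_cancel]
  · have hah : B (x - y) h = 0 := by
      rw [hB, map_sub, h1, h2, sub_zero]
    rw [hgv, hah, mul_zero, zero_div, zero_smul, sub_zero]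

theorem exists_orthogonal_apply_ne_zero [FiniteDimensional F V]
    {B : LinearMap.BilinForm F V} (hB : ∀ u v, B u v = B v u) (hnd : B.Nondegenerate)
    {H : Submodule F V} {x : V} (hx : x ∉ H) :
    ∃ w ∈ B.orthogonal H, B x w ≠ 0 := by
  by_contra! hcon
  have hrefl : B.IsRefl := fun u v h => by rw [hB, h]
  apply hx
  rw [← LinearMap.BilinForm.orthogonal_orthogonal hnd hrefl H]
  intro w hw
  rw [hB]
  exact hcon w hw

/-- Two isotropic vectors orthogonal to `H` and outside of `H` are exchanged by an isometry
which fixes `H` pointwise. -/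
theorem exists_isometry_fixing [FiniteDimensional F V] (hchar : (2 : F) ≠ 0)
    {B : LinearMap.BilinForm F V} (hB : ∀ u v, B u v = B v u) (hnd : B.Nondegenerate)
    {H : Submodule F V} {x y : V} (hxH : x ∉ H) (hyH : y ∉ H)
    (hx : B x x = 0) (hy : B y y = 0)
    (hHx : ∀ h ∈ H, B h x = 0) (hHy : ∀ h ∈ H, B h y = 0) :
    ∃ g : V ≃ₗ[F] V, IsIsometry B B g ∧ g x = y ∧ ∀ h ∈ H, g h = h := by
  by_cases hxy : B x y = 0
  swap
  · obtain ⟨g, hg, hgx, hgH⟩ := exists_isometry_of_apply_ne_zero hchar hB hx hy hxy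
    exact ⟨g, hg, hgx, fun h hh => hgH h (hHx h hh) (hHy h hh)⟩
  obtain ⟨w, hw, hxw, hyw⟩ : ∃ w ∈ B.orthogonal H, B x w ≠ 0 ∧ B y w ≠ 0 := by
    obtain ⟨w₁, hw₁, hx₁⟩ := exists_orthogonal_apply_ne_zero hB hnd hxH
    obtain ⟨w₂, hw₂, hy₂⟩ := exists_orthogonal_apply_ne_zero hB hnd hyH
    by_cases hy₁ : B y w₁ = 0
    · by_cases hx₂ : B x w₂ = 0
      · exact ⟨w₁ + w₂, add_mem hw₁ hw₂, by simpa [hx₂] using hx₁, by simpa [hy₁] using hy₂⟩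
      · exact ⟨w₂, hw₂, hx₂, hy₂⟩
    · exact ⟨w₁, hw₁, hx₁, hy₁⟩
  obtain ⟨v, hv, hHv, hxv, hvy⟩ : ∃ v, B v v = 0 ∧ (∀ h ∈ H, B h v = 0) ∧
      B x v ≠ 0 ∧ B v y ≠ 0 := by
    refine ⟨w - (B w w / (2 * B x w)) • x, ?_, fun h hh => ?_, ?_, ?_⟩
    · simp only [map_sub, map_smul, LinearMap.sub_apply, LinearMap.smul_apply, smul_eq_mul, hx,
        hB w x]
      field_simp
      ring
    · have hhw : B h w = 0 := hw h hh
      simp [hhw, hHx h hh]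
    · simpa [hx] using hxw
    · simpa [hxy, hB w y] using hyw
  obtain ⟨g₁, hg₁, hg₁x, hg₁H⟩ := exists_isometry_of_apply_ne_zero hchar hB hx hv hxv
  obtain ⟨g₂, hg₂, hg₂v, hg₂H⟩ := exists_isometry_of_apply_ne_zero hchar hB hv hy hvy
  refine ⟨g₁.trans g₂, hg₁.trans hg₂, by simp [hg₁x, hg₂v], fun h hh => ?_⟩
  rw [LinearEquiv.trans_apply, hg₁H h (hHx h hh) (hHv h hh), hg₂H h (hHv h hh) (hHy h hh)]

/-- Witt extension for totally isotropic subspaces: an isometry taking `N` to `N'` may be changed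
outside of `N` so that it takes the totally isotropic `U ≥ N` to `U' ≥ N'`. -/
theorem exists_isometry_map_eq [FiniteDimensional F V] [FiniteDimensional F V']
    (hchar : (2 : F) ≠ 0)
    {B : LinearMap.BilinForm F V} {B' : LinearMap.BilinForm F V'}
    (hB' : ∀ u v, B' u v = B' v u) (hnd' : B'.Nondegenerate)
    {U : Submodule F V} {U' : Submodule F V'} (hU : TotIsotropic B U) (hU' : TotIsotropic B' U')
    (hdim : finrank F U = finrank F U') (n : ℕ)
    {N : Submodule F V} {N' : Submodule F V'} (hn : finrank F U = finrank F N + n)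
    (hN : N ≤ U) (hN' : N' ≤ U')
    (g : V ≃ₗ[F] V') (hg : IsIsometry B B' g) (hgN : N.map g.toLinearMap = N') :
    ∃ φ : V ≃ₗ[F] V', IsIsometry B B' φ ∧ (∀ w ∈ N, φ w = g w) ∧
      U.map φ.toLinearMap = U' := by
  have hNN' : finrank F N = finrank F N' := by rw [← hgN, LinearEquiv.finrank_map_eq]
  induction n generalizing N N' g with
  | zero =>
    have h₁ : N = U := Submodule.eq_of_le_of_finrank_eq hN (by omega)
    have h₂ : N' = U' := Submodule.eq_of_le_of_finrank_eq hN' (by omega)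
    exact ⟨g, hg, fun _ _ => rfl, by rw [← h₁, hgN, h₂]⟩
  | succ n ih =>
    obtain ⟨x, hxU, hxN⟩ : ∃ x ∈ U, x ∉ N := by
      by_contra! h
      have := Submodule.finrank_mono (R := F) (show U ≤ N from h)
      omega
    obtain ⟨y, hyU, hyN⟩ : ∃ y ∈ U', y ∉ N' := by
      by_contra! h
      have := Submodule.finrank_mono (R := F) (show U' ≤ N' from h)
      omega
    have hgxN : g x ∉ N' := by
      rw [← hgN]
      rintro ⟨w, hw, hwx⟩
      exact hxN (g.injective hwx ▸ hw)
    have hNgx : ∀ h ∈ N', B' h (g x) = 0 := by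
      rw [← hgN]
      rintro _ ⟨w, hw, rfl⟩
      exact (hg w x).trans (hU w (hN hw) x hxU)
    obtain ⟨r, hr, hrx, hrN⟩ := exists_isometry_fixing hchar hB' hnd' hgxN hyN
      ((hg x x).trans (hU x hxU x hxU)) (hU' y hyU y hyU) hNgx
      (fun h hh => hU' h (hN' hh) y hyU)
    have hrg : ∀ w ∈ N, r (g w) = g w := fun w hw =>
      hrN _ (hgN ▸ Submodule.mem_map_of_mem hw)
    have hmap : N.map (g.trans r).toLinearMap = N' := by
      rw [← hgN]
      ext z
      simp only [Submodule.mem_map, LinearEquiv.coe_coe, LinearEquiv.trans_apply]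
      exact exists_congr fun w => and_congr_right fun hw => by rw [hrg w hw]
    have hmap' : (N ⊔ F ∙ x).map (g.trans r).toLinearMap = N' ⊔ F ∙ y := by
      rw [Submodule.map_sup, hmap, Submodule.map_span, Set.image_singleton]
      simp [hrx]
    have hNx : finrank F ↥(N ⊔ F ∙ x) = finrank F N + 1 :=
      Submodule.finrank_sup_span_singleton hxN
    obtain ⟨φ, hφ, hφN, hφU⟩ := ih (N := N ⊔ F ∙ x) (N' := N' ⊔ F ∙ y) (by omega)
      (sup_le hN (by simpa using hxU)) (sup_le hN' (by simpa using hyU))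
      (g.trans r) (hg.trans hr) hmap' (by rw [← hmap', LinearEquiv.finrank_map_eq])
    refine ⟨φ, hφ, fun w hw => ?_, hφU⟩
    rw [hφN w (Submodule.mem_sup_left hw), LinearEquiv.trans_apply, hrg w hw]

theorem IsIsometry.map_orthogonal {B : LinearMap.BilinForm F V} {B' : LinearMap.BilinForm F V'}
    {φ : V ≃ₗ[F] V'} (hφ : IsIsometry B B' φ) (N : Submodule F V) :
    (B.orthogonal N).map φ.toLinearMap = B'.orthogonal (N.map φ.toLinearMap) := by
  ext z
  obtain ⟨v, rfl⟩ := φ.surjective z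
  simp only [Submodule.mem_map, LinearEquiv.coe_coe, φ.injective.eq_iff, exists_eq_right,
    LinearMap.BilinForm.mem_orthogonal_iff,
    forall_exists_index, and_imp, forall_apply_eq_imp_iff₂, hφ _ _]

theorem le_of_step_le {k : ℕ} {𝒱 : ℕ → Submodule F V} (hmono : ∀ i < k, 𝒱 i ≤ 𝒱 (i + 1))
    {i j : ℕ} (hij : i ≤ j) (hj : j ≤ k) : 𝒱 i ≤ 𝒱 j := by
  induction j, hij using Nat.le_induction with
  | base => exact le_rfl
  | succ j _ ih => exact (ih (by omega)).trans (hmono j (by omega))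

theorem totIsotropic_of_selfDual {B : LinearMap.BilinForm F V} {k : ℕ} {𝒱 : ℕ → Submodule F V}
    (hmono : ∀ i < k, 𝒱 i ≤ 𝒱 (i + 1)) (hsd : ∀ i ≤ k, B.orthogonal (𝒱 i) = 𝒱 (k - i))
    {i : ℕ} (hi : i ≤ k / 2) : TotIsotropic B (𝒱 i) := fun u hu v hv => by
  have hv' : v ∈ B.orthogonal (𝒱 i) := by
    rw [hsd i (by omega)]
    exact le_of_step_le hmono (by omega) (by omega) hv
  exact hv' u hu

end Witt

/-- Lemma 3.1: two self-dual flags are isometric iff they have the same length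
and the dimensions of the first halves agree. -/
theorem witt_selfdual_flags_isometric_iff {F V V' : Type*} [Field F]
    [AddCommGroup V] [Module F V] [AddCommGroup V'] [Module F V']
    [FiniteDimensional F V] [FiniteDimensional F V']
    (hchar : (2 : F) ≠ 0)
    (B : LinearMap.BilinForm F V) (B' : LinearMap.BilinForm F V')
    (hB : ∀ u v : V, B u v = B v u) (hB' : ∀ u v : V', B' u v = B' v u)
    (hnd : B.Nondegenerate) (hnd' : B'.Nondegenerate)
    (hVV' : AreIsometric B B')
    (k k' : ℕ) (𝒱 : ℕ → Submodule F V) (𝒱' : ℕ → Submodule F V')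
    (h0 : 𝒱 0 = ⊥) (hk : 𝒱 k = ⊤) (hmono : ∀ i < k, 𝒱 i ≤ 𝒱 (i + 1))
    (h0' : 𝒱' 0 = ⊥) (hk' : 𝒱' k' = ⊤) (hmono' : ∀ i < k', 𝒱' i ≤ 𝒱' (i + 1))
    (hsd : ∀ i ≤ k, B.orthogonal (𝒱 i) = 𝒱 (k - i))
    (hsd' : ∀ i ≤ k', B'.orthogonal (𝒱' i) = 𝒱' (k' - i)) :
    (k = k' ∧ ∃ φV : V ≃ₗ[F] V', IsIsometry B B' φV ∧
        ∀ i ≤ k, (𝒱 i).map φV.toLinearMap = 𝒱' i) ↔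
      (k = k' ∧ ∀ i, 1 ≤ i → i ≤ k / 2 →
        finrank F ↥(𝒱 i) = finrank F ↥(𝒱' i)) := by
  constructor
  · rintro ⟨rfl, φ, -, hmap⟩
    refine ⟨rfl, fun i _ hi => ?_⟩
    rw [← hmap i (by omega), LinearEquiv.finrank_map_eq]
  · rintro ⟨rfl, hdim⟩
    refine ⟨rfl, ?_⟩
    have key : ∀ m ≤ k / 2, ∃ φ : V ≃ₗ[F] V', IsIsometry B B' φ ∧
        ∀ i ≤ m, (𝒱 i).map φ.toLinearMap = 𝒱' i := by
      intro m
      induction m with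
      | zero =>
        obtain ⟨ψ, hψ⟩ := hVV'
        refine fun _ => ⟨ψ, hψ, fun i hi => ?_⟩
        obtain rfl : i = 0 := by omega
        rw [h0, h0', Submodule.map_bot]
      | succ m ih =>
        intro hm
        obtain ⟨g, hg, hgm⟩ := ih (by omega)
        have hle : 𝒱 m ≤ 𝒱 (m + 1) := hmono m (by omega)
        obtain ⟨φ, hφ, hφg, hφm⟩ := exists_isometry_map_eq hchar hB' hnd'
          (totIsotropic_of_selfDual hmono hsd hm) (totIsotropic_of_selfDual hmono' hsd' hm)
          (hdim (m + 1) (by omega) hm) _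
          (Nat.add_sub_cancel' (Submodule.finrank_mono hle)).symm hle (hmono' m (by omega))
          g hg (hgm m le_rfl)
        refine ⟨φ, hφ, fun i hi => ?_⟩
        obtain rfl | hi := hi.eq_or_lt
        · exact hφm
        · rw [← hgm i (by omega)]
          ext z
          simp only [Submodule.mem_map, LinearEquiv.coe_coe]
          exact exists_congr fun w => and_congr_right fun hw => by
            rw [hφg w (le_of_step_le hmono (by omega) (by omega) hw)]
    obtain ⟨φ, hφ, hmap⟩ := key (k / 2) le_rfl
    refine ⟨φ, hφ, fun i hi => ?_⟩
    by_cases hik : i ≤ k / 2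
    · exact hmap i hik
    · have h := hsd (k - i) (by omega)
      have h' := hsd' (k - i) (by omega)
      rw [Nat.sub_sub_self hi] at h h'
      rw [← h, hφ.map_orthogonal, hmap (k - i) (by omega), h']
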